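/- arXiv:1902.01793 — 3 statements merged into one kernel-verified Lean document; each statement's English description precedes it below -/
import Mathlib

section
/- Let c > 0 and R > 0 be real numbers. Then ∫_R^∞ (c r / (r⁴ + c)) dr = (√c / 2) · arctan(√c / R²). -/
open MeasureTheory Real

/-- The closed form of the Rayleigh/`α = 4` interference integral (Corollary 1,
step (b)): for `c > 0` and `R > 0`,
`∫_R^∞ c r/(r⁴ + c) dr = (√c/2) arctan(√c/R²)`. -/
theorem rayleigh_alpha_four_integral (c R : ℝ) (hc : 0 < c) (hR : 0 < R) :
    ∫ r in Set.Ioi R, c * r / (r ^ 4 + c)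
      = (Real.sqrt c / 2) * Real.arctan (Real.sqrt c / R ^ 2) := by
  obtain ⟨s, hs, rfl⟩ : ∃ s : ℝ, 0 < s ∧ c = s ^ 2 :=
    ⟨√c, Real.sqrt_pos.2 hc, (Real.sq_sqrt hc.le).symm⟩
  rw [Real.sqrt_sq hs.le]
  have hderiv : ∀ r ∈ Set.Ici R, HasDerivAt (fun r : ℝ => -(s / 2 * Real.arctan (s / r ^ 2)))
      (s ^ 2 * r / (r ^ 4 + s ^ 2)) r := by
    intro r hr
    have hr0 : 0 < r := hR.trans_le hr
    have hdiv : HasDerivAt (fun r : ℝ => s / r ^ 2) (-(2 * s / r ^ 3)) r := by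
      refine ((hasDerivAt_const r s).div (hasDerivAt_pow 2 r) (by positivity)).congr_deriv ?_
      field_simp
      ring
    refine (hdiv.arctan.const_mul (s / 2)).neg.congr_deriv ?_
    field_simp
  have hlim : Filter.Tendsto (fun r : ℝ => -(s / 2 * Real.arctan (s / r ^ 2)))
      Filter.atTop (nhds 0) := by
    have hdiv : Filter.Tendsto (fun r : ℝ => s / r ^ 2) Filter.atTop (nhds 0) :=
      (Filter.tendsto_pow_atTop two_ne_zero).const_div_atTop s
    simpa using (((Real.continuous_arctan.tendsto 0).comp hdiv).const_mul (s / 2)).neg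
  rw [integral_Ioi_of_hasDerivAt_of_nonneg' hderiv _ hlim]
  · ring
  · intro r hr
    have hr0 : 0 < r := hR.trans hr
    positivity
end

section
/- Let α > 2, c > 0, R > 0 with c R^(−α) < 1, and set δ = 2/α. Then ∫_R^∞ (c r / (r^α + c)) dr = (c R^(2−α) / α) · Σ_{a=0}^∞ (−c R^(−α))^a / (1 − δ + a), and the series on the right converges. -/
open MeasureTheory Real

theorem neg_mul_rpow_neg_pow (α c : ℝ) {r : ℝ} (hr : 0 < r) (s : ℝ) (n : ℕ) :
    r ^ s * (-(c * r ^ (-α))) ^ n = (-c) ^ n * r ^ (s - α * n) := by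
  rw [← neg_mul, mul_pow, ← rpow_mul_natCast hr.le, sub_eq_add_neg, rpow_add hr, ← neg_mul]
  ring

theorem hasSum_rayleigh_integrand {α c r : ℝ} (hc : 0 < c) (hr : 0 < r)
    (hcr : c * r ^ (-α) < 1) :
    HasSum (fun n : ℕ => c * (r ^ (1 - α) * (-(c * r ^ (-α))) ^ n))
      (c * r / (r ^ α + c)) := by
  have hq : 0 < c * r ^ (-α) := by positivity
  have hgeom := hasSum_geometric_of_norm_lt_one (ξ := -(c * r ^ (-α)))
    (by rwa [norm_neg, norm_of_nonneg hq.le])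
  have hpos : 0 < r ^ α := by positivity
  have hvalue : c * r / (r ^ α + c) = c * (r ^ (1 - α) * (1 - -(c * r ^ (-α)))⁻¹) := by
    rw [rpow_sub hr, rpow_one, rpow_neg hr.le, sub_neg_eq_add]
    field_simp
  rw [hvalue]
  exact (hgeom.mul_left _).mul_left c

theorem hasSum_integral_rayleigh {α c R : ℝ} (hα : 2 < α) (hc : 0 < c) (hR : 0 < R)
    (hcR : c * R ^ (-α) < 1) :
    HasSum (fun n : ℕ => ∫ r in Set.Ioi R, c * (r ^ (1 - α) * (-(c * r ^ (-α))) ^ n))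
      (∫ r in Set.Ioi R, c * r / (r ^ α + c)) := by
  have hq : 0 ≤ c * R ^ (-α) := by positivity
  have hle : ∀ r ∈ Set.Ioi R, c * r ^ (-α) ≤ c * R ^ (-α) := fun r hr =>
    mul_le_mul_of_nonneg_left (rpow_le_rpow_of_nonpos hR (le_of_lt hr) (by linarith)) hc.le
  refine hasSum_integral_of_dominated_convergence
    (fun n r => c * (r ^ (1 - α) * (c * R ^ (-α)) ^ n)) (fun n => ?_) (fun n => ?_) ?_ ?_ ?_
  · exact Measurable.aestronglyMeasurable (by fun_prop)
  · filter_upwards [ae_restrict_mem measurableSet_Ioi] with r hr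
    have hr0 : 0 < r := hR.trans hr
    rw [norm_mul, norm_mul, norm_pow, norm_neg, norm_of_nonneg hc.le,
      norm_of_nonneg (rpow_nonneg hr0.le _), norm_of_nonneg (by positivity : 0 ≤ c * r ^ (-α))]
    gcongr c * (_ * ?_ ^ n)
    exact hle r hr
  · exact .of_forall fun r =>
      ((summable_geometric_of_lt_one hq hcR).mul_left _).mul_left _
  · simp_rw [tsum_mul_left]
    exact ((integrableOn_Ioi_rpow_of_lt (by linarith) hR).mul_const _).const_mul _
  · filter_upwards [ae_restrict_mem measurableSet_Ioi] with r hr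
    exact hasSum_rayleigh_integrand hc (hR.trans hr) ((hle r hr).trans_lt hcR)

theorem integral_rayleigh_term {α c R : ℝ} (hα : 2 < α) (hR : 0 < R) (n : ℕ) :
    ∫ r in Set.Ioi R, c * (r ^ (1 - α) * (-(c * r ^ (-α))) ^ n)
      = (c * R ^ (2 - α) / α) * ((-(c * R ^ (-α))) ^ n / (1 - 2 / α + n)) := by
  have hn : 0 ≤ α * n := by positivity
  have hden : 0 < α - 2 + α * n := by linarith
  have hcongr : ∫ r in Set.Ioi R, c * (r ^ (1 - α) * (-(c * r ^ (-α))) ^ n)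
      = ∫ r in Set.Ioi R, c * ((-c) ^ n * r ^ (1 - α - α * n)) :=
    setIntegral_congr_fun measurableSet_Ioi fun r hr => by
      simp only [neg_mul_rpow_neg_pow α c (hR.trans hr)]
  rw [hcongr, integral_const_mul, integral_const_mul,
    integral_Ioi_rpow_of_lt (by linarith) hR]
  calc c * ((-c) ^ n * (-R ^ (1 - α - α * n + 1) / (1 - α - α * n + 1)))
      = c * ((-c) ^ n * R ^ (2 - α - α * n)) / (α - 2 + α * n) := by
        rw [show 1 - α - α * n + 1 = 2 - α - α * n by ring,
          show 2 - α - α * n = -(α - 2 + α * n) by ring, neg_div_neg_eq]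
        ring
    _ = c * (R ^ (2 - α) * (-(c * R ^ (-α))) ^ n) / (α * (1 - 2 / α + n)) := by
        rw [neg_mul_rpow_neg_pow α c hR,
          show α * (1 - 2 / α + n) = α - 2 + α * n by field_simp]
    _ = _ := by rw [div_mul_div_comm, mul_assoc]

/-- Series form of the Rayleigh-interference integral for general path loss exponent
(step (a) of the paper's Corollary 1): for `α > 2`, `c > 0`, `R > 0` with
`c R^(−α) < 1` and `δ = 2/α`, the series `∑_{a=0}^∞ (−c R^(−α))^a/(1−δ+a)` converges,
and `∫_R^∞ c r/(r^α + c) dr = (c R^(2−α)/α) ∑_{a=0}^∞ (−c R^(−α))^a/(1−δ+a)`. -/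
theorem rayleigh_interference_series (α c R δ : ℝ)
    (hα : 2 < α) (hc : 0 < c) (hR : 0 < R) (hδ : δ = 2 / α)
    (hcR : c * R ^ (-α) < 1) :
    Summable (fun a : ℕ => (-(c * R ^ (-α))) ^ a / (1 - δ + a)) ∧
    ∫ r in Set.Ioi R, c * r / (r ^ α + c)
      = (c * R ^ (2 - α) / α) * ∑' a : ℕ, (-(c * R ^ (-α))) ^ a / (1 - δ + a) := by
  subst hδ
  have hsum := hasSum_integral_rayleigh hα hc hR hcR
  simp_rw [integral_rayleigh_term hα hR] at hsum
  have hne : c * R ^ (2 - α) / α ≠ 0 := by positivity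
  exact ⟨(summable_mul_left_iff hne).1 hsum.summable, by rw [← tsum_mul_left, hsum.tsum_eq]⟩
end

section
/- Let P > 0, G > 0, σ² > 0, I ≥ 0, ε > 0 and a_w, a_v > 0 be real numbers with a_v ≤ ε a_w. Then for every A ≥ 0, (A · a_v · G · P) / (σ² + A · a_w · G · P + I) < ε. In particular, the far-user coverage event {SINR > ε} is empty under this power allocation. -/
/-- Remark 2, first half: under the inappropriate power allocation `a_v ≤ ε a_w`,
the far user's SINR `(A a_v G P)/(σ² + A a_w G P + I)` is below the threshold `ε`
for every channel gain `A ≥ 0`, i.e. the far-user coverage event is empty. -/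
theorem far_user_coverage_empty (P G σ2 I ε aw av : ℝ)
    (hP : 0 < P) (hG : 0 < G) (hσ : 0 < σ2) (hI : 0 ≤ I) (hε : 0 < ε)
    (haw : 0 < aw) (hav : 0 < av) (hpa : av ≤ ε * aw) :
    ∀ A : ℝ, 0 ≤ A →
      (A * av * G * P) / (σ2 + A * aw * G * P + I) < ε := by
  intro A hA
  have hgain : 0 ≤ A * G * P := by positivity
  rw [div_lt_iff₀ (by positivity)]
  nlinarith [mul_le_mul_of_nonneg_left hpa hgain, mul_pos hε hσ, mul_nonneg hε.le hI]
end
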